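/- arXiv:2304.10793 — 2 statements merged into one kernel-verified Lean document; each statement's English description precedes it below -/
import Mathlib

section
/- Let s, k ∈ ℕ, let G be a finite abelian group, let I be a finite nonempty indexing set, and for each i ∈ I let H_{i1}, …, H_{is} be subgroups of G. There exist natural numbers w_1, …, w_k and t ∈ ℕ, all depending only on s and k, such that for every 1-bounded function f : G → ℂ, ( E_{i∈I} ‖f‖_{H_{i1}, …, H_{is}}^{2^s} )^t ≤ E over all families (i_ε)_{ε∈{0,1}^{w_1+⋯+w_k}} ∈ I^{{0,1}^{w_1+⋯+w_k}} of the box norm of f along the family of subgroups Σ_{b_1,…,b_k ∈ {0,1}} H_{i_{ε_{1b_1}⋯ε_{kb_k}}, j}, indexed by j ∈ {1,…,s} and by all tuples (ε_{10}, ε_{11}, …, ε_{k0}, ε_{k1}) with ε_{l0}, ε_{l1} ∈ {0,1}^{w_l} and ε_{l0} ≠ ε_{l1} for each l = 1,…,k, where ε_{1b_1}⋯ε_{kb_k} ∈ {0,1}^{w_1+⋯+w_k} denotes the concatenation of the tuples ε_{1b_1}, …, ε_{kb_k}. -/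
open Finset Polynomial
open scoped BigOperators

noncomputable section

/-- The average of a complex-valued function over a finite type. -/
def eavg {α : Type*} [Finite α] (f : α → ℂ) : ℂ :=
  haveI := Fintype.ofFinite α
  (∑ x, f x) / (Nat.card α : ℂ)

/-- The average of a real-valued function over a finite type. -/
def eavgR {α : Type*} [Finite α] (f : α → ℝ) : ℝ :=
  haveI := Fintype.ofFinite α
  (∑ x, f x) / (Nat.card α : ℝ)

/-- Iterated complex conjugation `C^n`. -/
def conjIter (n : ℕ) (z : ℂ) : ℂ := if Even n then z else (starRingEnd ℂ) z

/-- The weight `|ε|` of a Boolean vector. -/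
def epsWt {ι : Type*} [Finite ι] (ε : ι → Bool) : ℕ :=
  haveI := Fintype.ofFinite ι
  ∑ i, if ε i then 1 else 0

/-- The Gowers box norm of `f` along a finite family of subgroups of `G`. -/
def boxNorm {G : Type*} [AddCommGroup G] [Finite G] {ι : Type*} [Finite ι]
    (H : ι → AddSubgroup G) (f : G → ℂ) : ℝ :=
  haveI := Fintype.ofFinite ι
  haveI : Fintype (ι → Bool) := Fintype.ofFinite _
  ((eavg fun x : G => eavg fun h : ∀ i, H i =>
      ∏ ε : ι → Bool,
        conjIter (epsWt ε) (f (x + ∑ i, if ε i then (h i : G) else 0))).re) ^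
    ((1 : ℝ) / 2 ^ Nat.card ι)

/-- Reduction of an integer vector modulo `p`. -/
def redv (p : ℕ) {D : ℕ} (w : Fin D → ℤ) : Fin D → ZMod p := fun k => (w k : ZMod p)

/-- The vector `v·P(n)` in `F_p^D`. -/
def pshift (p : ℕ) {D : ℕ} (v : Fin D → ℤ) (P : Polynomial ℤ) (n : ZMod p) :
    Fin D → ZMod p :=
  fun k => (v k : ZMod p) * Polynomial.aeval n P

/-- The Gowers norm of degree `s` of `f` along the direction `v`. -/
def gowersU (p : ℕ) [NeZero p] {D : ℕ} (s : ℕ) (v : Fin D → ℤ)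
    (f : (Fin D → ZMod p) → ℂ) : ℝ :=
  (eavg fun x : Fin D → ZMod p => eavg fun h : Fin s → ZMod p =>
      ∏ ε : Fin s → Bool,
        conjIter (epsWt ε)
          (f (x + fun k => (∑ i, if ε i then h i else 0) * (v k : ZMod p)))).re ^
    ((1 : ℝ) / 2 ^ s)

/-- The conditional expectation `E(f | v)`. -/
def condAvg (p : ℕ) [NeZero p] {D : ℕ} (v : Fin D → ℤ)
    (f : (Fin D → ZMod p) → ℂ) (x : Fin D → ZMod p) : ℂ :=
  eavg fun n : ZMod p => f (x + fun k => n * (v k : ZMod p))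

/-- The additive character `e_p`. -/
def ep (p : ℕ) (t : ZMod p) : ℂ :=
  Complex.exp (2 * Real.pi * Complex.I * (t.val : ℂ) / (p : ℂ))

/-- `χ` is an eigenfunction of the direction `v`. -/
def IsEigenfunction (p : ℕ) {D : ℕ} (v : Fin D → ℤ) (χ : (Fin D → ZMod p) → ℂ) : Prop :=
  ∃ φ : (Fin D → ZMod p) → ZMod p,
    (∀ x, ‖χ x‖ = 0 ∨ ‖χ x‖ = 1) ∧
    (∀ x, χ (x + redv p v) = ep p (φ x) * χ x) ∧
    (∀ x, φ (x + redv p v) = φ x)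

/-- The degree-`s'` dual function of `g` along `v`. -/
def dualFn (p : ℕ) [NeZero p] {D : ℕ} (s' : ℕ) (v : Fin D → ℤ)
    (g : (Fin D → ZMod p) → ℂ) (x : Fin D → ZMod p) : ℂ :=
  eavg fun h : Fin s' → ZMod p =>
    ∏ ε ∈ Finset.univ.filter (fun ε : Fin s' → Bool => ε ≠ fun _ => false),
      conjIter (epsWt ε)
        (g (x + fun k => (∑ i, if ε i then h i else 0) * (v k : ZMod p)))

/-- Membership in `𝔇_s(v)`. -/
def MemDual (p : ℕ) [NeZero p] {D : ℕ} (s : ℕ) (v : Fin D → ℤ)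
    (Df : (Fin D → ZMod p) → ℂ) : Prop :=
  ∃ (s' : ℕ) (g : (Fin D → ZMod p) → ℂ),
    1 ≤ s' ∧ s' ≤ s ∧ (∀ x, ‖g x‖ ≤ 1) ∧ Df = dualFn p s' v g

section Averages

variable {α β : Type*} [Finite α] [Finite β]

lemma eavg_eq_sum [Fintype α] (f : α → ℂ) : eavg f = (∑ x, f x) / (Nat.card α : ℂ) := by
  unfold eavg
  congr!

lemma eavgR_eq_sum [Fintype α] (f : α → ℝ) : eavgR f = (∑ x, f x) / (Nat.card α : ℝ) := by
  unfold eavgR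
  congr!

lemma eavg_comm (F : α → β → ℂ) :
    eavg (fun x => eavg fun y => F x y) = eavg fun y => eavg fun x => F x y := by
  have := Fintype.ofFinite α
  have := Fintype.ofFinite β
  simp only [eavg_eq_sum, ← Finset.sum_div]
  rw [Finset.sum_comm, div_right_comm]

lemma eavgR_comm (F : α → β → ℝ) :
    eavgR (fun x => eavgR fun y => F x y) = eavgR fun y => eavgR fun x => F x y := by
  have := Fintype.ofFinite α
  have := Fintype.ofFinite β
  simp only [eavgR_eq_sum, ← Finset.sum_div]
  rw [Finset.sum_comm, div_right_comm]

lemma eavg_prod (F : α × β → ℂ) :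
    eavg F = eavg fun x => eavg fun y => F (x, y) := by
  have := Fintype.ofFinite α
  have := Fintype.ofFinite β
  simp only [eavg_eq_sum, ← Finset.sum_div]
  rw [Fintype.sum_prod_type, Nat.card_prod, Nat.cast_mul, div_div, mul_comm (Nat.card α : ℂ)]

lemma eavgR_prod (F : α × β → ℝ) :
    eavgR F = eavgR fun x => eavgR fun y => F (x, y) := by
  have := Fintype.ofFinite α
  have := Fintype.ofFinite β
  simp only [eavgR_eq_sum, ← Finset.sum_div]
  rw [Fintype.sum_prod_type, Nat.card_prod, Nat.cast_mul, div_div, mul_comm (Nat.card α : ℝ)]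

lemma eavg_equiv (e : α ≃ β) (f : β → ℂ) : eavg (fun x => f (e x)) = eavg f := by
  have := Fintype.ofFinite α
  have := Fintype.ofFinite β
  rw [eavg_eq_sum, eavg_eq_sum, Equiv.sum_comp e f, Nat.card_congr e]

lemma eavgR_equiv (e : α ≃ β) (f : β → ℝ) : eavgR (fun x => f (e x)) = eavgR f := by
  have := Fintype.ofFinite α
  have := Fintype.ofFinite β
  rw [eavgR_eq_sum, eavgR_eq_sum, Equiv.sum_comp e f, Nat.card_congr e]

lemma mul_eavg (c : ℂ) (f : α → ℂ) : c * eavg f = eavg fun x => c * f x := by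
  have := Fintype.ofFinite α
  simp only [eavg_eq_sum, ← Finset.mul_sum, mul_div_assoc]

lemma eavg_mul (f : α → ℂ) (c : ℂ) : eavg f * c = eavg fun x => f x * c := by
  simp only [mul_comm _ c, mul_eavg]

lemma conj_eavg (f : α → ℂ) :
    (starRingEnd ℂ) (eavg f) = eavg fun x => (starRingEnd ℂ) (f x) := by
  have := Fintype.ofFinite α
  simp only [eavg_eq_sum, map_div₀, map_sum, map_natCast]

lemma eavg_re (f : α → ℂ) : (eavg f).re = eavgR fun x => (f x).re := by
  have := Fintype.ofFinite α
  simp only [eavg_eq_sum, eavgR_eq_sum, Complex.div_natCast_re, Complex.re_sum]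

lemma eavg_const [Nonempty α] (c : ℂ) : eavg (fun _ : α => c) = c := by
  have := Fintype.ofFinite α
  rw [eavg_eq_sum, Finset.sum_const, Finset.card_univ, Nat.card_eq_fintype_card, nsmul_eq_mul,
    mul_div_cancel_left₀]
  exact_mod_cast Fintype.card_ne_zero

lemma eavgR_const [Nonempty α] (c : ℝ) : eavgR (fun _ : α => c) = c := by
  have := Fintype.ofFinite α
  rw [eavgR_eq_sum, Finset.sum_const, Finset.card_univ, Nat.card_eq_fintype_card, nsmul_eq_mul,
    mul_div_cancel_left₀]
  exact_mod_cast Fintype.card_ne_zero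

lemma eavgR_mono {f g : α → ℝ} (h : ∀ x, f x ≤ g x) : eavgR f ≤ eavgR g := by
  have := Fintype.ofFinite α
  rw [eavgR_eq_sum, eavgR_eq_sum]
  gcongr
  exact h _

lemma eavgR_nonneg {f : α → ℝ} (h : ∀ x, 0 ≤ f x) : 0 ≤ eavgR f := by
  have := Fintype.ofFinite α
  rw [eavgR_eq_sum]
  exact div_nonneg (Finset.sum_nonneg fun x _ => h x) (Nat.cast_nonneg _)

lemma norm_eavg_le (f : α → ℂ) : ‖eavg f‖ ≤ eavgR fun x => ‖f x‖ := by
  have := Fintype.ofFinite α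
  rw [eavg_eq_sum, eavgR_eq_sum, norm_div, Complex.norm_natCast]
  gcongr
  exact norm_sum_le _ _

lemma norm_eavg_le_one [Nonempty α] {f : α → ℂ} (h : ∀ x, ‖f x‖ ≤ 1) : ‖eavg f‖ ≤ 1 :=
  (norm_eavg_le f).trans ((eavgR_mono h).trans_eq (eavgR_const 1))

lemma eavgR_pow_le [Nonempty α] {f : α → ℝ} (h : ∀ x, 0 ≤ f x) (n : ℕ) :
    eavgR f ^ n ≤ eavgR fun x => f x ^ n := by
  have := Fintype.ofFinite α
  have hc : (Nat.card α : ℝ) ≠ 0 := by exact_mod_cast Nat.card_pos.ne'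
  have := Real.pow_arith_mean_le_arith_mean_pow Finset.univ (fun _ : α => (Nat.card α : ℝ)⁻¹) f
    (fun _ _ => by positivity) (by simp [← Nat.card_eq_fintype_card, hc]) (fun x _ => h x) n
  simpa only [eavgR_eq_sum, ← Finset.mul_sum, div_eq_inv_mul] using this

lemma eavg_add_right [AddGroup α] (c : α) (f : α → ℂ) : eavg (fun x => f (x + c)) = eavg f :=
  eavg_equiv (Equiv.addRight c) f

lemma eavg_comp_surjective {M N : Type*} [AddGroup M] [AddCommGroup N] [Finite M] [Finite N]
    (θ : M →+ N) (hθ : Function.Surjective θ) (ψ : N → ℂ) :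
    eavg (fun m => ψ (θ m)) = eavg ψ := by
  have h : ∀ n : N, eavg (fun m => ψ (θ m + n)) = eavg fun m => ψ (θ m) := fun n => by
    obtain ⟨c, rfl⟩ := hθ n
    simpa only [map_add] using eavg_add_right c (fun m => ψ (θ m))
  calc eavg (fun m => ψ (θ m)) = eavg fun n : N => eavg fun m : M => ψ (θ m + n) := by
        simp only [h, eavg_const]
    _ = eavg ψ := by
        rw [eavg_comm]
        simp only [fun m n => add_comm (θ m) n, eavg_add_right, eavg_const]

/-- Averaging over tuples indexed by a larger set does not change the average. -/
lemma eavgR_comp_injective {V W I : Type*} [Finite V] [Finite W] [Finite I] [Nonempty I]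
    (e : V → W) (he : Function.Injective e) (F : (V → I) → ℝ) :
    eavgR (fun i : W → I => F (fun v => i (e v))) = eavgR F := by
  classical
  let E : V ⊕ (((Set.range e)ᶜ : Set W)) ≃ W :=
    (Equiv.sumCongr (Equiv.ofInjective e he) (Equiv.refl _)).trans (Equiv.Set.sumCompl _)
  let E' : (W → I) ≃ (V → I) × (((Set.range e)ᶜ : Set W) → I) :=
    (Equiv.arrowCongr E.symm (Equiv.refl I)).trans (Equiv.sumArrowEquivProdArrow _ _ _)
  have h : ∀ i : W → I, F (fun v => i (e v)) = (fun p : (V → I) × _ => F p.1) (E' i) := by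
    intro i
    rfl
  simp only [h]
  rw [eavgR_equiv E' (fun p => F p.1), eavgR_prod]
  simp only [eavgR_const]

lemma normSq_eavg (f : α → ℂ) :
    ‖eavg f‖ ^ 2 = (eavg fun x => eavg fun y => f x * (starRingEnd ℂ) (f y)).re := by
  simp only [← mul_eavg, ← eavg_mul, ← conj_eavg]
  rw [Complex.mul_conj, Complex.ofReal_re, Complex.normSq_eq_norm_sq]

/-- Cauchy–Schwarz against a `1`-bounded function. -/
lemma norm_eavg_mul_sq_le {u F : α → ℂ} [Nonempty α] (hu : ∀ x, ‖u x‖ ≤ 1) :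
    ‖eavg fun x => u x * F x‖ ^ 2 ≤ eavgR fun x => ‖F x‖ ^ 2 := by
  refine le_trans ?_ (eavgR_pow_le (fun x => norm_nonneg (F x)) 2)
  gcongr
  refine (norm_eavg_le _).trans (eavgR_mono fun x => ?_)
  rw [norm_mul]
  exact mul_le_of_le_one_left (norm_nonneg _) (hu x)

end Averages

section CubeAverages

universe u v

lemma conjIter_mul (n : ℕ) (z w : ℂ) : conjIter n (z * w) = conjIter n z * conjIter n w := by
  unfold conjIter
  split_ifs <;> simp

lemma conjIter_succ (n : ℕ) (z : ℂ) : conjIter (n + 1) z = conjIter n ((starRingEnd ℂ) z) := by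
  unfold conjIter
  by_cases h : Even n <;> simp [h, Nat.even_add_one]

lemma norm_conjIter (n : ℕ) (z : ℂ) : ‖conjIter n z‖ = ‖z‖ := by
  unfold conjIter
  split_ifs <;> simp

lemma epsWt_eq_sum {ι : Type*} [Fintype ι] (ε : ι → Bool) :
    epsWt ε = ∑ i, if ε i then 1 else 0 := by
  unfold epsWt
  congr!

/-- The box average of `f` along a family of homomorphisms into `G`; the box norm is a root of it
when the homomorphisms are inclusions of subgroups. -/
def cubeAvg {G : Type*} [AddCommGroup G] [Finite G] {A : Type*} [Finite A] {M : A → Type*}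
    [∀ a, AddCommGroup (M a)] [∀ a, Finite (M a)] (τ : ∀ a, M a →+ G) (f : G → ℂ) : ℂ :=
  haveI := Fintype.ofFinite A
  haveI : Fintype (A → Bool) := Fintype.ofFinite _
  eavg fun x : G => eavg fun h : ∀ a, M a =>
    ∏ ε : A → Bool, conjIter (epsWt ε) (f (x + ∑ a, if ε a then τ a (h a) else 0))

/-- The multiplicative derivative of `f` in the direction `m`. -/
def mulDeriv {G : Type*} [AddCommGroup G] (m : G) (f : G → ℂ) (x : G) : ℂ :=
  f x * (starRingEnd ℂ) (f (x + m))

lemma norm_mulDeriv_le_one {G : Type*} [AddCommGroup G] {f : G → ℂ} (hf : ∀ x, ‖f x‖ ≤ 1) (m x : G) :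
    ‖mulDeriv m f x‖ ≤ 1 := by
  rw [mulDeriv, norm_mul, RCLike.norm_conj]
  exact mul_le_one₀ (hf _) (norm_nonneg _) (hf _)

variable {G : Type*} [AddCommGroup G] [Finite G]

lemma cubeAvg_eq {A : Type*} [Fintype A] [DecidableEq A] {M : A → Type*}
    [∀ a, AddCommGroup (M a)] [∀ a, Finite (M a)] (τ : ∀ a, M a →+ G) (f : G → ℂ) :
    cubeAvg τ f = eavg fun x : G => eavg fun h : ∀ a, M a =>
      ∏ ε : A → Bool, conjIter (epsWt ε) (f (x + ∑ a, if ε a then τ a (h a) else 0)) := by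
  unfold cubeAvg
  congr!

lemma cubeAvg_isEmpty {A : Type*} [Finite A] [IsEmpty A] {M : A → Type*}
    [∀ a, AddCommGroup (M a)] [∀ a, Finite (M a)] (τ : ∀ a, M a →+ G) (f : G → ℂ) :
    cubeAvg τ f = eavg f := by
  classical
  have := Fintype.ofFinite A
  rw [cubeAvg_eq]
  simp [eavg_const, conjIter, epsWt_eq_sum]

lemma cubeAvg_equiv {A B : Type*} [Finite A] [Finite B] (e : A ≃ B) {M : B → Type*}
    [∀ a, AddCommGroup (M a)] [∀ a, Finite (M a)] (τ : ∀ a, M a →+ G) (f : G → ℂ) :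
    cubeAvg (fun a => τ (e a)) f = cubeAvg τ f := by
  classical
  have := Fintype.ofFinite A
  have := Fintype.ofFinite B
  rw [cubeAvg_eq, cubeAvg_eq]
  congr 1
  funext x
  rw [← eavg_equiv (Equiv.piCongrLeft M e)]
  congr 1
  funext h
  refine Fintype.prod_equiv (Equiv.arrowCongr e (Equiv.refl Bool)) _ _ fun ε => ?_
  congr 1
  · rw [epsWt_eq_sum, epsWt_eq_sum]
    exact Fintype.sum_equiv e _ _ fun a => by simp [Equiv.arrowCongr]
  · congr 2
    refine Fintype.sum_equiv e _ _ fun a => ?_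
    simp [Equiv.arrowCongr]

lemma cubeAvg_option {A : Type*} [Finite A] {M : Option A → Type*}
    [∀ a, AddCommGroup (M a)] [∀ a, Finite (M a)] (τ : ∀ a, M a →+ G) (f : G → ℂ) :
    cubeAvg τ f = eavg fun m : M none =>
      cubeAvg (fun a => τ (some a)) (mulDeriv (τ none m) f) := by
  classical
  have := Fintype.ofFinite A
  simp only [cubeAvg_eq]
  rw [eavg_comm (α := M none)]
  congr 1
  funext x
  rw [← eavg_equiv (Equiv.piOptionEquivProd (β := M)).symm, eavg_prod]
  congr 1
  funext m
  congr 1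
  funext h
  rw [← Equiv.prod_comp (Equiv.piOptionEquivProd (β := fun _ : Option A => Bool)).symm,
    Fintype.prod_prod_type, Fintype.prod_bool, ← Finset.prod_mul_distrib]
  refine Finset.prod_congr rfl fun ε _ => ?_
  have hw : ∀ b, epsWt ((Equiv.piOptionEquivProd (β := fun _ : Option A => Bool)).symm (b, ε)) =
      epsWt ε + if b then 1 else 0 := fun b => by
    rw [epsWt_eq_sum, epsWt_eq_sum, Fintype.sum_option, add_comm]
    rfl
  have hs : ∀ b, (∑ a, if (Equiv.piOptionEquivProd (β := fun _ : Option A => Bool)).symm (b, ε) a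
      then τ a ((Equiv.piOptionEquivProd (β := M)).symm (m, h) a) else 0) =
      (if b then τ none m else 0) + ∑ a, if ε a then τ (some a) (h a) else 0 := fun b => by
    rw [Fintype.sum_option]
    rfl
  rw [hw, hw, hs, hs, mulDeriv, conjIter_mul, mul_comm]
  simp only [Bool.false_eq_true, if_true, if_false, add_zero, zero_add, conjIter_succ]
  rw [add_comm (τ none m), add_assoc]

lemma cubeAvg_comp {Ω : Type*} [AddCommGroup Ω] [Finite Ω] (π : Ω →+ G)
    (hπ : Function.Surjective π) {A : Type*} [Finite A] {M : A → Type*}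
    [∀ a, AddCommGroup (M a)] [∀ a, Finite (M a)] (τ : ∀ a, M a →+ Ω) (f : G → ℂ) :
    cubeAvg τ (fun ω => f (π ω)) = cubeAvg (fun a => π.comp (τ a)) f := by
  classical
  have := Fintype.ofFinite A
  rw [cubeAvg_eq, cubeAvg_eq, ← eavg_comp_surjective π hπ]
  simp only [map_add, map_sum, apply_ite π, map_zero, AddMonoidHom.comp_apply]

lemma cubeAvg_translate {A : Type*} [Finite A] {M : A → Type*}
    [∀ a, AddCommGroup (M a)] [∀ a, Finite (M a)] (τ : ∀ a, M a →+ G) (f : G → ℂ) (c : G) :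
    cubeAvg τ (fun x => f (x + c)) = cubeAvg τ f := by
  classical
  have := Fintype.ofFinite A
  rw [cubeAvg_eq, cubeAvg_eq]
  refine Eq.trans ?_ (eavg_add_right c _)
  simp only [add_right_comm]

lemma norm_cubeAvg_le_one {A : Type*} [Finite A] {M : A → Type*}
    [∀ a, AddCommGroup (M a)] [∀ a, Finite (M a)] (τ : ∀ a, M a →+ G) {f : G → ℂ}
    (hf : ∀ x, ‖f x‖ ≤ 1) : ‖cubeAvg τ f‖ ≤ 1 := by
  classical
  have := Fintype.ofFinite A
  rw [cubeAvg_eq]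
  refine norm_eavg_le_one fun x => norm_eavg_le_one fun h => ?_
  rw [norm_prod]
  exact Finset.prod_le_one (fun _ _ => norm_nonneg _) fun ε _ => by
    rw [norm_conjIter]; exact hf _

/-- The van der Corput inequality: correlation with an invariant function is controlled by
averages of multiplicative derivatives. -/
lemma norm_eavg_invariant_mul_sq_le {M : Type*} [AddCommGroup M] [Finite M] (τ : M →+ G)
    {φ : G → ℂ} (hφ : ∀ x, ‖φ x‖ ≤ 1) (hinv : ∀ x m, φ (x + τ m) = φ x) (F : G → ℂ) :
    ‖eavg fun x => φ x * F x‖ ^ 2 ≤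
      (eavg fun m : M => eavg fun x => mulDeriv (τ m) F x).re := by
  have h1 : (eavg fun x => φ x * F x) = eavg fun x => φ x * eavg fun m : M => F (x + τ m) := by
    simp only [mul_eavg]
    rw [eavg_comm]
    have : ∀ m : M, (eavg fun x => φ x * F (x + τ m)) = eavg fun x => φ x * F x := fun m => by
      rw [← eavg_add_right (τ m) fun x => φ x * F x]
      simp only [hinv]
    simp only [this, eavg_const]
  rw [h1]
  refine (norm_eavg_mul_sq_le hφ).trans_eq ?_
  simp only [normSq_eavg]
  rw [← eavg_re]
  congr 1
  rw [eavg_comm]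
  have h2 : ∀ m : M, (eavg fun x => eavg fun n : M => F (x + τ m) * (starRingEnd ℂ) (F (x + τ n)))
      = eavg fun n : M => eavg fun x => mulDeriv (τ n) F x := fun m => by
    rw [eavg_comm, ← eavg_add_right m]
    congr 1
    funext n
    refine Eq.trans ?_ (eavg_add_right (τ m) _)
    simp only [mulDeriv, map_add, add_assoc, add_comm (τ m)]
  simp only [h2, eavg_const]

/-- The Gowers–Cauchy–Schwarz inequality for functions correlating with a product of
invariant functions. -/
lemma norm_eavg_mul_prod_pow_le {A : Type u} [Fintype A] [Nonempty A] {M : A → Type v}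
    [∀ a, AddCommGroup (M a)] [∀ a, Finite (M a)] (τ : ∀ a, M a →+ G) (φ : A → G → ℂ)
    (hφ : ∀ a x, ‖φ a x‖ ≤ 1) (hinv : ∀ a x m, φ a (x + τ a m) = φ a x) (F : G → ℂ) :
    ‖eavg fun x => F x * ∏ a, φ a x‖ ^ 2 ^ Fintype.card A ≤ (cubeAvg τ F).re := by
  let P : ∀ (A : Type u) [Fintype A], Prop := fun A _ =>
    ∀ [Nonempty A] {M : A → Type v}
    [∀ a, AddCommGroup (M a)] [∀ a, Finite (M a)] (τ : ∀ a, M a →+ G) (φ : A → G → ℂ)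
    (_ : ∀ a x, ‖φ a x‖ ≤ 1) (_ : ∀ a x m, φ a (x + τ a m) = φ a x) (F : G → ℂ),
    ‖eavg fun x => F x * ∏ a, φ a x‖ ^ 2 ^ Fintype.card A ≤ (cubeAvg τ F).re
  suffices h : P A from h τ φ hφ hinv F
  clear hφ hinv F φ τ
  refine Fintype.induction_empty_option (P := P) ?_ ?_ ?_ A
  · intro A B _ e ih _ M _ _ τ φ hφ hinv F
    have := Fintype.ofEquiv B e.symm
    have := e.nonempty
    rw [← cubeAvg_equiv e, ← Fintype.card_congr e]
    simp only [← Equiv.prod_comp e]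
    convert ih (fun a => τ (e a)) (fun a => φ (e a)) (fun a => hφ _) (fun a => hinv _) F
  · intro h
    exact (not_isEmpty_of_nonempty _ (inferInstance : IsEmpty PEmpty)).elim
  · intro A _ ih _ M _ _ τ φ hφ hinv F
    set c : M none → ℂ := fun m =>
      eavg fun x => mulDeriv (τ none m) F x * ∏ a, mulDeriv (τ none m) (φ (some a)) x with hc
    have h1 : ‖eavg fun x => F x * ∏ a, φ a x‖ ^ 2 ≤ (eavg c).re := by
      have := norm_eavg_invariant_mul_sq_le (τ none) (hφ none) (hinv none)
        fun x => F x * ∏ a, φ (some a) x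
      convert this using 3
      · congr 1
        funext x
        rw [Fintype.prod_option]
        ring
      · rw [hc]
        funext m
        congr 1
        funext x
        simp only [mulDeriv, map_mul, map_prod, Finset.prod_mul_distrib]
        ring
    rw [cubeAvg_option, Fintype.card_option, pow_succ', pow_mul]
    cases isEmpty_or_nonempty A with
    | inl h =>
      simp only [Fintype.card_of_isEmpty, pow_zero, pow_one, cubeAvg_isEmpty]
      simpa [hc] using h1
    | inr h =>
      calc (‖eavg fun x => F x * ∏ a, φ a x‖ ^ 2) ^ 2 ^ Fintype.card A
          ≤ (eavgR fun m => ‖c m‖) ^ 2 ^ Fintype.card A := by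
            gcongr
            exact h1.trans ((Complex.re_le_norm _).trans (norm_eavg_le _))
        _ ≤ eavgR fun m => ‖c m‖ ^ 2 ^ Fintype.card A := eavgR_pow_le (fun _ => norm_nonneg _) _
        _ ≤ eavgR fun m => (cubeAvg (fun a => τ (some a)) (mulDeriv (τ none m) F)).re :=
            eavgR_mono fun m => ih _ _ (fun a => norm_mulDeriv_le_one (hφ _) _)
              (fun a x n => by simp only [mulDeriv, add_right_comm x, hinv]) _
        _ = _ := (eavg_re _).symm

lemma cubeAvg_re_nonneg {A : Type*} [Finite A] [Nonempty A] {M : A → Type*}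
    [∀ a, AddCommGroup (M a)] [∀ a, Finite (M a)] (τ : ∀ a, M a →+ G) (f : G → ℂ) :
    0 ≤ (cubeAvg τ f).re := by
  have := Fintype.ofFinite A
  exact le_trans (by positivity) (norm_eavg_mul_prod_pow_le τ (fun _ _ => 1) (by simp) (by simp) f)

end CubeAverages

section Structured

variable {G : Type*} [AddCommGroup G]

/-- The box average of `f` along a family of subgroups. -/
def subBox [Finite G] {A : Type*} [Finite A] (H : A → AddSubgroup G) (f : G → ℂ) : ℂ :=
  cubeAvg (fun a => (H a).subtype) f

/-- A function on `G × Y` is structured if it is a product of `1`-bounded functions, the one with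
index `b` being invariant under the graph of `ρ b` over the subgroup `L b`. -/
def IsStructured {Y : Type*} [AddCommGroup Y] {B : Type*} [Fintype B] (L : B → AddSubgroup G)
    (ρ : ∀ b, L b →+ Y) (Φ : G × Y → ℂ) : Prop :=
  ∃ φ : B → G × Y → ℂ, (∀ b ω, ‖φ b ω‖ ≤ 1) ∧
    (∀ b ω (m : L b), φ b (ω + ((m : G), ρ b m)) = φ b ω) ∧ ∀ ω, Φ ω = ∏ b, φ b ω

namespace IsStructured

variable {Y : Type*} [AddCommGroup Y] {B : Type*} [Fintype B] {L : B → AddSubgroup G}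
  {ρ : ∀ b, L b →+ Y} {Φ Ψ : G × Y → ℂ}

lemma one : IsStructured L ρ 1 :=
  ⟨fun _ _ => 1, by simp, by simp, by simp⟩

lemma mul (hΦ : IsStructured L ρ Φ) (hΨ : IsStructured L ρ Ψ) : IsStructured L ρ (Φ * Ψ) := by
  obtain ⟨φ, h1, h2, h3⟩ := hΦ
  obtain ⟨ψ, k1, k2, k3⟩ := hΨ
  refine ⟨fun b ω => φ b ω * ψ b ω, fun b ω => ?_, fun b ω m => ?_, fun ω => ?_⟩
  · rw [norm_mul]
    exact mul_le_one₀ (h1 _ _) (norm_nonneg _) (k1 _ _)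
  · simp only [h2, k2]
  · rw [Pi.mul_apply, h3, k3, Finset.prod_mul_distrib]

lemma prod {E : Type*} (s : Finset E) (Φ : E → G × Y → ℂ)
    (h : ∀ e ∈ s, IsStructured L ρ (Φ e)) : IsStructured L ρ (∏ e ∈ s, Φ e) :=
  Finset.prod_induction _ _ (fun _ _ => mul) one h

lemma conj (hΦ : IsStructured L ρ Φ) :
    IsStructured L ρ (fun ω => (starRingEnd ℂ) (Φ ω)) := by
  obtain ⟨φ, h1, h2, h3⟩ := hΦ
  exact ⟨fun b ω => (starRingEnd ℂ) (φ b ω), fun b ω => by simpa using h1 b ω,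
    fun b ω m => by simp only [h2], fun ω => by simp only [h3, map_prod]⟩

lemma of_invariant (b : B) (h1 : ∀ ω, ‖Φ ω‖ ≤ 1)
    (h2 : ∀ ω (m : L b), Φ (ω + ((m : G), ρ b m)) = Φ ω) : IsStructured L ρ Φ := by
  classical
  refine ⟨fun b' ω => if b' = b then Φ ω else 1, fun b' ω => ?_, fun b' ω m => ?_, fun ω => ?_⟩
  · dsimp only
    split_ifs
    exacts [h1 ω, by simp]
  · dsimp only
    split_ifs with h
    · subst h
      exact h2 ω m
    · rfl
  · simp

lemma comp {Y' : Type*} [AddCommGroup Y'] {ρ' : ∀ b, L b →+ Y'} (hΦ : IsStructured L ρ Φ)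
    (ν : Y' →+ Y) (hν : ∀ b m, ν (ρ' b m) = ρ b m) :
    IsStructured L ρ' (fun ω => Φ (ω.1, ν ω.2)) := by
  obtain ⟨φ, h1, h2, h3⟩ := hΦ
  refine ⟨fun b ω => φ b (ω.1, ν ω.2), fun b ω => h1 _ _, fun b ω m => ?_, fun ω => h3 _⟩
  simpa [hν] using h2 b (ω.1, ν ω.2) m

lemma norm_eavg_pow_le [Finite G] [Finite Y] [Nonempty B] (hΦ : IsStructured L ρ Φ) (g : G → ℂ) :
    ‖eavg fun x => eavg fun y => g x * Φ (x, y)‖ ^ 2 ^ Fintype.card B ≤ (subBox L g).re := by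
  obtain ⟨φ, h1, h2, h3⟩ := hΦ
  have := norm_eavg_mul_prod_pow_le (fun b => (L b).subtype.prod (ρ b)) φ h1
    (fun b ω m => h2 b ω m) (fun ω => g ω.1)
  have hb := cubeAvg_comp (AddMonoidHom.fst G Y) Prod.fst_surjective
    (fun b => (L b).subtype.prod (ρ b)) g
  rw [subBox]
  simp only [AddMonoidHom.fst_comp_prod, AddMonoidHom.coe_fst] at hb
  rw [← hb]
  simp only [h3]
  rwa [eavg_prod] at this

end IsStructured

/-- The homomorphism `L b → ∏ a, H a` subtracting an element in every coordinate over `b`. -/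
lemma exists_shiftHom {A B : Type*} [DecidableEq B] {H : A → AddSubgroup G}
    {L : B → AddSubgroup G} (p : A → B) (hp : ∀ a, L (p a) ≤ H a) :
    ∃ σ : ∀ b, L b →+ (∀ a, H a), ∀ b m a, ((σ b m a : H a) : G) = if p a = b then -(m : G) else 0 := by
  refine ⟨fun b => AddMonoidHom.pi fun a => if h : p a = b then
    -AddSubgroup.inclusion (h ▸ hp a) else 0, fun b m a => ?_⟩
  by_cases h : p a = b <;> simp [h]

/-- The product of the factors of the box average other than the base point. -/
def cubeProd {A : Type*} [Fintype A] [DecidableEq A] (H : A → AddSubgroup G) (F : G → ℂ)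
    (ω : G × ∀ a, H a) : ℂ :=
  ∏ ε ∈ (Finset.univ : Finset (A → Bool)).erase (fun _ => false),
    conjIter (epsWt ε) (F (ω.1 + ∑ a, if ε a then (ω.2 a : G) else 0))

lemma subBox_eq_cubeProd [Finite G] {A : Type*} [Fintype A] [DecidableEq A] (H : A → AddSubgroup G)
    (F : G → ℂ) :
    subBox H F = eavg fun x => eavg fun h : ∀ a, H a => F x * cubeProd H F (x, h) := by
  rw [subBox, cubeAvg_eq]
  congr! 4 with x h
  rw [cubeProd, ← Finset.mul_prod_erase _ _ (Finset.mem_univ fun _ => false)]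
  congr 1
  simp [epsWt_eq_sum, conjIter]

lemma isStructured_cubeProd {A B : Type*} [Fintype A] [DecidableEq A] [Fintype B] [DecidableEq B]
    {H : A → AddSubgroup G} {L : B → AddSubgroup G} {p : A → B} (hp : Function.Injective p)
    {σ : ∀ b, L b →+ (∀ a, H a)}
    (hσ : ∀ b m a, ((σ b m a : H a) : G) = if p a = b then -(m : G) else 0)
    {F : G → ℂ} (hF : ∀ x, ‖F x‖ ≤ 1) : IsStructured L σ (cubeProd H F) := by
  have : cubeProd H F = ∏ ε ∈ (Finset.univ : Finset (A → Bool)).erase (fun _ => false),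
      fun ω : G × ∀ a, H a =>
        conjIter (epsWt ε) (F (ω.1 + ∑ a, if ε a then (ω.2 a : G) else 0)) := by
    funext ω
    rw [cubeProd, Finset.prod_apply]
  rw [this]
  refine IsStructured.prod _ _ fun ε hε => ?_
  obtain ⟨a₀, ha₀⟩ : ∃ a, ε a = true := by
    by_contra! h
    exact (Finset.mem_erase.1 hε).1 (funext fun a => by simpa using h a)
  refine IsStructured.of_invariant (p a₀) (fun ω => by rw [norm_conjIter]; exact hF _)
    fun ω m => ?_
  congr 2
  have h1 : ∀ a, (if ε a then (((ω + ((m : G), σ (p a₀) m)).2 a : H a) : G) else 0) =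
      (if ε a then (ω.2 a : G) else 0) + if a = a₀ then -(m : G) else 0 := fun a => by
    simp only [Prod.snd_add, Pi.add_apply, AddSubgroup.coe_add, hσ, hp.eq_iff]
    by_cases h : a = a₀
    · subst h
      simp [ha₀]
    · simp [h]
  simp only [h1, Finset.sum_add_distrib, Finset.sum_ite_eq', Finset.mem_univ, if_true,
    Prod.fst_add]
  abel

variable [Finite G]

/-- Monotonicity of box averages in the family of subgroups. -/
lemma norm_subBox_pow_le {A B : Type*} [Finite A] [Fintype B] [Nonempty B]
    {H : A → AddSubgroup G} {L : B → AddSubgroup G} {p : A → B} (hp : Function.Injective p)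
    (hL : ∀ a, L (p a) ≤ H a) {f : G → ℂ} (hf : ∀ x, ‖f x‖ ≤ 1) :
    ‖subBox H f‖ ^ 2 ^ Fintype.card B ≤ (subBox L f).re := by
  classical
  have := Fintype.ofFinite A
  obtain ⟨σ, hσ⟩ := exists_shiftHom p hL
  rw [subBox_eq_cubeProd H f]
  exact (isStructured_cubeProd hp hσ hf).norm_eavg_pow_le f

lemma subBox_option {A : Type*} [Finite A] (H : Option A → AddSubgroup G) (f : G → ℂ) :
    subBox H f = eavg fun m : H none => subBox (fun a => H (some a)) (mulDeriv (m : G) f) :=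
  cubeAvg_option _ _

lemma subBox_equiv {A B : Type*} [Finite A] [Finite B] (e : A ≃ B) (H : B → AddSubgroup G)
    (f : G → ℂ) : subBox (fun a => H (e a)) f = subBox H f :=
  cubeAvg_equiv e (fun b => (H b).subtype) f

lemma eavg_sub_of_eq_sup {K K' S : AddSubgroup G} (hS : S = K ⊔ K') (ψ : G → ℂ) :
    (eavg fun k : K => eavg fun k' : K' => ψ ((k : G) - k')) = eavg fun m : S => ψ m := by
  subst hS
  let θ : K × K' →+ (K ⊔ K' : AddSubgroup G) :=
    (AddSubgroup.inclusion le_sup_left).coprod (-AddSubgroup.inclusion le_sup_right)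
  have hθ : Function.Surjective θ := by
    rintro ⟨x, hx⟩
    obtain ⟨y, hy, z, hz, rfl⟩ := AddSubgroup.mem_sup.1 hx
    refine ⟨(⟨y, hy⟩, ⟨-z, neg_mem hz⟩), ?_⟩
    ext
    simp [θ]
  rw [← eavg_comp_surjective θ hθ, eavg_prod]
  simp [θ, sub_eq_add_neg]

/-- One direction `none` of a family of box averages is concatenated, while the remaining
directions of the two copies are merged into a single family. -/
lemma eavgR_subBox_pow_le {A B I : Type*} [Finite A] [Fintype B] [Nonempty B] [Finite I]
    [Nonempty I] {H : I → Option A → AddSubgroup G} {L : I → I → Option B → AddSubgroup G}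
    {p q : A → B} (hp : Function.Injective p) (hq : Function.Injective q)
    (hLp : ∀ i j a, L i j (some (p a)) ≤ H i (some a))
    (hLq : ∀ i j a, L i j (some (q a)) ≤ H j (some a))
    (hL : ∀ i j, L i j none = H i none ⊔ H j none) {f : G → ℂ} (hf : ∀ x, ‖f x‖ ≤ 1) :
    (eavgR fun i => (subBox (H i) f).re) ^ 2 ^ (Fintype.card B + 1) ≤
      eavgR fun i => eavgR fun j => (subBox (L i j) f).re := by
  classical
  have := Fintype.ofFinite A
  set n := Fintype.card B
  let D : ∀ i, H i none → G → ℂ := fun i k x => eavg fun h : ∀ a, H i (some a) =>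
    (starRingEnd ℂ) (f (x + k)) * cubeProd (fun a => H i (some a)) (mulDeriv (k : G) f) (x, h)
  have h1 : ∀ i, subBox (H i) f = eavg fun x => f x * eavg fun k => D i k x := fun i => by
    rw [subBox_option]
    simp only [D, subBox_eq_cubeProd, mul_eavg]
    rw [eavg_comm]
    simp only [mulDeriv, mul_assoc]
  have h2 : ‖eavg fun i => subBox (H i) f‖ ^ 2 ≤
      eavgR fun i => eavgR fun j => eavgR fun k : H i none => eavgR fun k' : H j none =>
        ‖eavg fun x => D i k x * (starRingEnd ℂ) (D j k' x)‖ := by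
    simp only [h1]
    rw [eavg_comm]
    simp only [← mul_eavg]
    refine (norm_eavg_mul_sq_le hf).trans ?_
    simp only [normSq_eavg]
    rw [← eavg_re]
    refine (Complex.re_le_norm _).trans ?_
    rw [eavg_comm]
    refine (norm_eavg_le _).trans (eavgR_mono fun i => ?_)
    rw [eavg_comm]
    refine (norm_eavg_le _).trans (eavgR_mono fun j => ?_)
    simp only [conj_eavg (fun k => D j k _), eavg_mul, mul_eavg]
    rw [eavg_comm]
    refine (norm_eavg_le _).trans (le_of_le_of_eq (eavgR_mono fun k' => ?_) (eavgR_comm _))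
    rw [eavg_comm]
    exact norm_eavg_le _
  have h3 : ∀ i j (k : H i none) (k' : H j none),
      ‖eavg fun x => D i k x * (starRingEnd ℂ) (D j k' x)‖ ^ 2 ^ n ≤
        (subBox (fun b => L i j (some b)) (mulDeriv ((k : G) - k') f)).re := by
    intro i j k k'
    obtain ⟨σ, hσ⟩ := exists_shiftHom (H := fun a => H i (some a)) (L := fun b => L i j (some b)) p
      (hLp i j)
    obtain ⟨σ', hσ'⟩ := exists_shiftHom (H := fun a => H j (some a)) (L := fun b => L i j (some b)) q
      (hLq i j)
    have hs := ((isStructured_cubeProd hp hσ (norm_mulDeriv_le_one hf (k : G))).comp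
      (ρ' := fun b => (σ b).prod (σ' b)) (AddMonoidHom.fst _ _) (fun _ _ => rfl)).mul
      ((isStructured_cubeProd hq hσ' (norm_mulDeriv_le_one hf (k' : G))).conj.comp
      (ρ' := fun b => (σ b).prod (σ' b)) (AddMonoidHom.snd _ _) (fun _ _ => rfl))
    have := hs.norm_eavg_pow_le fun x => (starRingEnd ℂ) (f (x + k)) * f (x + k')
    have ht : subBox (fun b => L i j (some b)) (fun x => (starRingEnd ℂ) (f (x + k)) * f (x + k'))
        = subBox (fun b => L i j (some b)) (mulDeriv ((k : G) - k') f) := by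
      rw [subBox, subBox, ← cubeAvg_translate _ (mulDeriv _ f) (k' : G)]
      congr 1
      funext x
      rw [mulDeriv, mul_comm]
      congr 3
      abel
    rw [← ht]
    refine le_of_eq_of_le ?_ this
    congr 2
    congr 1
    funext x
    simp only [D]
    rw [conj_eavg, eavg_mul, eavg_prod]
    congr 1
    funext h
    rw [mul_eavg]
    congr 1
    funext h'
    simp
    ring
  calc (eavgR fun i => (subBox (H i) f).re) ^ 2 ^ (n + 1)
      = ((eavgR fun i => (subBox (H i) f).re) ^ 2) ^ 2 ^ n := by rw [← pow_mul, pow_succ']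
    _ ≤ (‖eavg fun i => subBox (H i) f‖ ^ 2) ^ 2 ^ n := by
        rw [← eavg_re]
        refine pow_le_pow_left₀ (sq_nonneg _) ?_ _
        rw [← sq_abs]
        gcongr
        exact Complex.abs_re_le_norm _
    _ ≤ (eavgR fun i => eavgR fun j => eavgR fun k : H i none => eavgR fun k' : H j none =>
        ‖eavg fun x => D i k x * (starRingEnd ℂ) (D j k' x)‖) ^ 2 ^ n := by gcongr
    _ ≤ eavgR fun i => eavgR fun j => eavgR fun k : H i none => eavgR fun k' : H j none =>
        ‖eavg fun x => D i k x * (starRingEnd ℂ) (D j k' x)‖ ^ 2 ^ n := by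
      have h0 : ∀ i j (k : H i none) (k' : H j none),
        0 ≤ ‖eavg fun x => D i k x * (starRingEnd ℂ) (D j k' x)‖ := fun _ _ _ _ => norm_nonneg _
      refine (eavgR_pow_le (fun i => eavgR_nonneg fun j => eavgR_nonneg fun k =>
        eavgR_nonneg fun k' => h0 _ _ _ _) _).trans (eavgR_mono fun i => ?_)
      refine (eavgR_pow_le (fun j => eavgR_nonneg fun k =>
        eavgR_nonneg fun k' => h0 _ _ _ _) _).trans (eavgR_mono fun j => ?_)
      refine (eavgR_pow_le (fun k => eavgR_nonneg fun k' => h0 _ _ _ _) _).trans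
        (eavgR_mono fun k => ?_)
      exact eavgR_pow_le (fun k' => h0 _ _ _ _) _
    _ ≤ eavgR fun i => eavgR fun j => eavgR fun k : H i none => eavgR fun k' : H j none =>
        (subBox (fun b => L i j (some b)) (mulDeriv ((k : G) - k') f)).re :=
      eavgR_mono fun i => eavgR_mono fun j => eavgR_mono fun k => eavgR_mono fun k' => h3 i j k k'
    _ = eavgR fun i => eavgR fun j => (subBox (L i j) f).re := by
      congr 1
      funext i
      congr 1
      funext j
      simp only [← eavg_re]
      rw [subBox_option, eavg_sub_of_eq_sup (hL i j)
        (fun m => subBox (fun b => L i j (some b)) (mulDeriv m f))]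

end Structured

/-! ### Concatenation along a single set of indices -/

/-- Triples `(j, u, u')` in which the diagonal `u = u'` is only allowed when `j ∈ U u`. -/
abbrev DiagIndex {J V : Type} (U : V → Finset J) : Type :=
  {q : J × V × V // q.2.1 = q.2.2 → q.1 ∈ U q.2.1}

/-- The pairwise sums of the subgroups `H (i u) j`, indexed by `DiagIndex U`. -/
def pairSup {G I : Type*} [AddCommGroup G] {J V : Type} (U : V → Finset J) (H : I → J → AddSubgroup G) (i : V → I)
    (q : DiagIndex U) : AddSubgroup G :=
  H (i q.1.2.1) q.1.1 ⊔ H (i q.1.2.2) q.1.1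

lemma eavgR_option {V I : Type*} [Finite V] [Finite I] (F : (Option V → I) → ℝ) :
    eavgR F = eavgR fun i : V → I => eavgR fun a => F fun o => o.elim a i := by
  rw [eavgR_comm, ← eavgR_prod (fun x : I × (V → I) => F fun o => o.elim x.1 x.2),
    ← eavgR_equiv (Equiv.piOptionEquivProd (β := fun _ : Option V => I)).symm]
  congr 1
  ext x
  congr 1
  ext o
  cases o <;> rfl

lemma eavgR_update {V I : Type*} [Finite V] [DecidableEq V] [Finite I] [Nonempty I] (v : V)
    (F : (V → I) → ℝ) :
    eavgR F = eavgR fun i : V → I => eavgR fun a => F (Function.update i v a) := by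
  let e : V → Option V := fun u => if u = v then none else some u
  have he : Function.Injective e := fun u u' h => by
    simp only [e] at h
    split_ifs at h <;> simp_all
  rw [← eavgR_comp_injective e he F, eavgR_option]
  congr 1; ext i; congr 1; ext a; congr 1; ext u
  by_cases h : u = v
  · subst h; simp [e]
  · simp [e, h]

/-- The set of admissible diagonals after the diagonal `j₀` at `v` has been removed by
duplicating the variable `v`. -/
def splitDiag {J V : Type} [DecidableEq J] [DecidableEq V] (U : V → Finset J) (v : V) (j₀ : J)
    (o : Option V) : Finset J :=
  o.elim ((U v).erase j₀) (Function.update U v ((U v).erase j₀))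

lemma eavgR_pairSup_split_le {J V : Type} [Finite J] [DecidableEq J] [Finite V] [DecidableEq V]
    (U : V → Finset J) (v : V) {j₀ : J} (hj : j₀ ∈ U v) :
    ∃ t, 0 < t ∧ ∀ (G : Type*) [AddCommGroup G] [Finite G] (I : Type*) [Finite I] [Nonempty I]
      (H : I → J → AddSubgroup G) (f : G → ℂ), (∀ x, ‖f x‖ ≤ 1) →
      (eavgR fun i : V → I => (subBox (pairSup U H i) f).re) ^ t ≤
        eavgR fun i : Option V → I => (subBox (pairSup (splitDiag U v j₀) H i) f).re := by
  classical
  let a₀ : DiagIndex U := ⟨(j₀, v, v), fun _ => hj⟩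
  let b₀ : DiagIndex (splitDiag U v j₀) := ⟨(j₀, some v, none), fun h => by simp at h⟩
  let A := {a : DiagIndex U // a ≠ a₀}
  let B := {b : DiagIndex (splitDiag U v j₀) // b ≠ b₀}
  have : Fintype B := Fintype.ofFinite _
  have : Nonempty B := ⟨⟨⟨(j₀, none, some v), fun h => by simp at h⟩, by simp [b₀]⟩⟩
  let σ : V → Option V := fun u => if u = v then none else some u
  have hσ : Function.Injective σ := fun u u' h => by
    simp only [σ] at h
    split_ifs at h <;> simp_all
  have hσv : ∀ u, σ u ≠ some v := fun u => by
    simp only [σ]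
    split_ifs with h <;> simp [h]
  have hdiag : ∀ a : A, a.1.1.2.1 = a.1.1.2.2 → a.1.1.2.1 = v → a.1.1.1 ≠ j₀ := by
    rintro ⟨⟨⟨j, u, u'⟩, h⟩, ha⟩ h1 h2 h3
    simp only at h1 h2 h3
    subst h1 h2 h3
    exact ha rfl
  let p : A → B := fun a => ⟨⟨(a.1.1.1, some a.1.1.2.1, some a.1.1.2.2), fun h => by
    have h := Option.some_injective _ h
    have := a.1.2 h
    have h' := hdiag a h
    simp only [splitDiag, Option.elim]
    by_cases hv : a.1.1.2.1 = v
    · rw [hv, Function.update_self]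
      exact Finset.mem_erase.2 ⟨h' hv, hv ▸ this⟩
    · rwa [Function.update_of_ne hv]⟩, by simp [b₀]⟩
  let q : A → B := fun a => ⟨⟨(a.1.1.1, σ a.1.1.2.1, σ a.1.1.2.2), fun h => by
    have h := hσ h
    have := a.1.2 h
    have h' := hdiag a h
    by_cases hv : a.1.1.2.1 = v
    · simp only [σ, hv, splitDiag, Option.elim, if_true]
      exact Finset.mem_erase.2 ⟨h' hv, hv ▸ this⟩
    · simpa only [σ, hv, splitDiag, Option.elim, if_false, Function.update_of_ne hv,
        ne_eq, not_false_eq_true]⟩, fun h => hσv a.1.1.2.1 (by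
      simpa using congrArg (fun b => b.1.2.1) h)⟩
  have hp : Function.Injective p := by
    rintro ⟨⟨⟨j, u, u'⟩, h⟩, ha⟩ ⟨⟨⟨k, w, w'⟩, h'⟩, ha'⟩ h
    have h := congrArg (fun b => b.1.1) h
    exact Subtype.ext (Subtype.ext (by simpa [p] using h))
  have hq : Function.Injective q := by
    rintro ⟨⟨⟨j, u, u'⟩, h⟩, ha⟩ ⟨⟨⟨k, w, w'⟩, h'⟩, ha'⟩ h
    have h := congrArg (fun b => b.1.1) h
    exact Subtype.ext (Subtype.ext (by simpa [q, hσ.eq_iff] using h))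
  refine ⟨2 ^ (Fintype.card B + 1), by positivity, fun G _ _ I _ _ H f hf => ?_⟩
  rw [eavgR_option, eavgR_update v fun i => (subBox (pairSup U H i) f).re,
    eavgR_update v fun i => eavgR fun a => 
      (subBox (pairSup (splitDiag U v j₀) H fun o => o.elim a i) f).re]
  refine (eavgR_pow_le (fun i => eavgR_nonneg fun a => ?_) _).trans (eavgR_mono fun i => ?_)
  · have : Nonempty (DiagIndex U) := ⟨a₀⟩
    exact cubeAvg_re_nonneg _ f
  · have key := eavgR_subBox_pow_le (A := A) (B := B) (I := I)
      (H := fun a o => pairSup U H (Function.update i v a) (Equiv.optionSubtypeNe a₀ o))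
      (L := fun a a' o => pairSup (splitDiag U v j₀) H
        (fun x => x.elim a' (Function.update i v a)) (Equiv.optionSubtypeNe b₀ o))
      hp hq ?_ ?_ ?_ hf
    · simpa only [subBox_equiv] using key
    · intro a a' x
      simp [pairSup, p]
    · intro a a' x
      have hs : ∀ u, (σ u).elim a' (Function.update i v a) = Function.update i v a' u := fun u => by
        by_cases hu : u = v
        · subst hu; simp [σ]
        · simp [σ, hu]
      simp [pairSup, q, hs]
    · intro a a'
      simp [pairSup, a₀, b₀]

lemma eavgR_subBox_pow_le_of_injective {G A B I : Type*} [AddCommGroup G] [Finite G] [Finite A]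
    [Fintype B] [Nonempty B] [Finite I] [Nonempty I] {H : I → A → AddSubgroup G}
    {L : I → B → AddSubgroup G} {p : A → B} (hp : Function.Injective p)
    (hL : ∀ i a, L i (p a) ≤ H i a) {f : G → ℂ} (hf : ∀ x, ‖f x‖ ≤ 1) :
    (eavgR fun i => (subBox (H i) f).re) ^ 2 ^ Fintype.card B ≤
      eavgR fun i => (subBox (L i) f).re := by
  rw [← eavg_re]
  refine (le_abs_self _).trans ?_
  rw [abs_pow]
  refine (pow_le_pow_left₀ (abs_nonneg _)
    ((Complex.abs_re_le_norm _).trans (norm_eavg_le _)) _).trans ?_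
  exact (eavgR_pow_le (fun i => norm_nonneg _) _).trans
    (eavgR_mono fun i => norm_subBox_pow_le hp (hL i) hf)

lemma sum_splitDiag_lt {J V : Type} [DecidableEq J] [Fintype V] [DecidableEq V]
    (U : V → Finset J) (v : V) {j₀ : J} (hj : j₀ ∈ U v) :
    ∑ o, (2 ^ (splitDiag U v j₀ o).card - 1) < ∑ u, (2 ^ (U u).card - 1) := by
  have h1 : ∑ u, (2 ^ (Function.update U v ((U v).erase j₀) u).card - 1) =
      (2 ^ ((U v).erase j₀).card - 1) +
        ∑ u ∈ Finset.univ.erase v, (2 ^ (U u).card - 1) := by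
    rw [← Finset.add_sum_erase _ _ (Finset.mem_univ v), Function.update_self]
    congr 1
    refine Finset.sum_congr rfl fun u hu => ?_
    rw [Function.update_of_ne (Finset.ne_of_mem_erase hu)]
  rw [Fintype.sum_option]
  simp only [splitDiag, Option.elim]
  rw [h1, ← Finset.add_sum_erase _ _ (Finset.mem_univ v), ← Finset.card_erase_add_one hj, pow_succ]
  have := Nat.one_le_two_pow (n := ((U v).erase j₀).card)
  omega

lemma exists_eavgR_pairSup_empty (J : Type) [Finite J] (n : ℕ) :
    ∀ (V : Type) [Fintype V] (U : V → Finset J), ∑ v, (2 ^ (U v).card - 1) ≤ n →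
    ∃ (V' : Type) (_ : Finite V') (t : ℕ), 0 < t ∧
      ∀ (G : Type*) [AddCommGroup G] [Finite G] (I : Type*) [Finite I] [Nonempty I]
        (H : I → J → AddSubgroup G) (f : G → ℂ), (∀ x, ‖f x‖ ≤ 1) →
        (eavgR fun i : V → I => (subBox (pairSup U H i) f).re) ^ t ≤
          eavgR fun i : V' → I => (subBox (pairSup (fun _ => ∅) H i) f).re := by
  classical
  induction n with
  | zero =>
    intro V _ U hU
    have hU' : U = fun _ => ∅ := by
      ext1 v
      have := (Finset.sum_eq_zero_iff.1 (Nat.le_zero.1 hU)) v (Finset.mem_univ v)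
      by_contra hv
      have := Nat.one_lt_two_pow (Finset.card_ne_zero_of_mem
        (Finset.nonempty_iff_ne_empty.2 hv).choose_spec)
      omega
    subst hU'
    exact ⟨V, inferInstance, 1, one_pos, fun G _ _ I _ _ H f _ => (pow_one _).le⟩
  | succ n ih =>
    intro V _ U hU
    by_cases hU' : U = fun _ => ∅
    · subst hU'
      exact ⟨V, inferInstance, 1, one_pos, fun G _ _ I _ _ H f _ => (pow_one _).le⟩
    obtain ⟨v, hv⟩ := Function.ne_iff.1 hU'
    obtain ⟨j₀, hj⟩ := Finset.nonempty_iff_ne_empty.2 hv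
    obtain ⟨t, ht, h⟩ := eavgR_pairSup_split_le U v hj
    obtain ⟨V', hV', t', ht', h'⟩ := ih (Option V) (splitDiag U v j₀)
      (Nat.le_of_lt_succ ((sum_splitDiag_lt U v hj).trans_le hU))
    refine ⟨V', hV', t * t', Nat.mul_pos ht ht', fun G _ _ I _ _ H f hf => ?_⟩
    have : Nonempty (DiagIndex U) := ⟨⟨(j₀, v, v), fun _ => hj⟩⟩
    rw [pow_mul]
    exact (pow_le_pow_left₀ (pow_nonneg (eavgR_nonneg fun i => cubeAvg_re_nonneg _ f) _)
      (h G I H f hf) _).trans (h' G I H f hf)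

lemma exists_eavgR_subBox_cube (J : Type) [Finite J] [Nonempty J] :
    ∃ w t : ℕ, 0 < w ∧ 0 < t ∧
      ∀ (G : Type*) [AddCommGroup G] [Finite G] (I : Type*) [Finite I] [Nonempty I]
        (H : I → J → AddSubgroup G) (f : G → ℂ), (∀ x, ‖f x‖ ≤ 1) →
        (eavgR fun i => (subBox (H i) f).re) ^ t ≤
          eavgR fun ii : (Fin w → Bool) → I => (subBox
            (fun q : {q : J × (Bool → Fin w → Bool) // q.2 false ≠ q.2 true} =>
              ⨆ b, H (ii (q.1.2 b)) q.1.1) f).re := by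
  classical
  have := Fintype.ofFinite J
  let U : Unit → Finset J := fun _ => Finset.univ
  obtain ⟨V, hV, t, ht, h⟩ := exists_eavgR_pairSup_empty J _ Unit U le_rfl
  have := Fintype.ofFinite V
  let w := Fintype.card V + 1
  have hcard : Fintype.card V ≤ Fintype.card (Fin w → Bool) := by
    simpa [w] using ((Nat.lt_succ_self _).trans Nat.lt_two_pow_self).le
  obtain ⟨e⟩ := Function.Embedding.nonempty_of_card_le hcard
  let B := {q : J × (Bool → Fin w → Bool) // q.2 false ≠ q.2 true}
  have : Fintype B := Fintype.ofFinite _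
  have : Nonempty B := ⟨⟨(Classical.arbitrary J, fun b _ => b), fun h => by
    simpa using congrFun h 0⟩⟩
  let A := DiagIndex U
  have : Nonempty A := ⟨⟨(Classical.arbitrary J, (), ()), fun _ => Finset.mem_univ _⟩⟩
  have : Fintype A := Fintype.ofFinite _
  refine ⟨w, 2 ^ Fintype.card A * t * 2 ^ Fintype.card B, Nat.succ_pos _, by positivity,
    fun G _ _ I _ _ H f hf => ?_⟩
  have h0 : 0 ≤ eavgR fun i => (subBox (H i) f).re :=
    eavgR_nonneg fun i => cubeAvg_re_nonneg _ f
  have h1 : (eavgR fun i => (subBox (H i) f).re) ^ 2 ^ Fintype.card A ≤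
      eavgR fun i : Unit → I => (subBox (pairSup U H i) f).re := by
    rw [← eavgR_equiv (Equiv.funUnique Unit I).symm]
    refine eavgR_subBox_pow_le_of_injective
      (p := fun j => (⟨(j, (), ()), fun _ => Finset.mem_univ _⟩ : A)) ?_ ?_ hf
    · intro j j' hjj
      simpa using congrArg (fun a => a.1.1) hjj
    · intro i j
      simp [pairSup]
  rw [pow_mul, pow_mul]
  refine (pow_le_pow_left₀ (by positivity) ((pow_le_pow_left₀ (by positivity) h1 _).trans
    (h G I H f hf)) _).trans ?_
  rw [← eavgR_comp_injective e e.injective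
    fun i : V → I => (subBox (pairSup (fun _ => ∅) H i) f).re]
  refine eavgR_subBox_pow_le_of_injective (p := fun a => (⟨(a.1.1, fun b =>
      if b then e a.1.2.2 else e a.1.2.1), fun hne => ?_⟩ : B)) ?_ ?_ hf
  · simpa using a.2 (e.injective (by simpa using hne))
  · rintro ⟨⟨j, u, u'⟩, ha⟩ ⟨⟨k, v, v'⟩, ha'⟩ haa
    have h2 := congrArg (fun b => b.1.1) haa
    have h3 := congrArg (fun b => b.1.2 false) haa
    have h4 := congrArg (fun b => b.1.2 true) haa
    simp at h2 h3 h4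
    simp [h2, h3, h4]
  · intro i a
    refine iSup_le fun b => ?_
    cases b <;> simp [pairSup]

/-! ### Iterated concatenation -/

lemma exists_eavgR_subBox_iterated (k : ℕ) : ∀ (J : Type) [Finite J] [Nonempty J],
    ∃ (w : Fin k → ℕ) (t : ℕ), (∀ l, 0 < w l) ∧ 0 < t ∧
      ∀ (G : Type*) [AddCommGroup G] [Finite G] (I : Type*) [Finite I] [Nonempty I]
        (H : I → J → AddSubgroup G) (f : G → ℂ), (∀ x, ‖f x‖ ≤ 1) →
        (eavgR fun i => (subBox (H i) f).re) ^ t ≤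
          eavgR fun ii : ((Σ l : Fin k, Fin (w l)) → Bool) → I => (subBox
            (fun q : {q : J × ((l : Fin k) → Bool → Fin (w l) → Bool) //
                ∀ l, q.2 l false ≠ q.2 l true} =>
              ⨆ b : Fin k → Bool,
                H (ii fun z : Σ l : Fin k, Fin (w l) => q.1.2 z.1 (b z.1) z.2) q.1.1) f).re := by
  classical
  induction k with
  | zero =>
    intro J _ _
    let B := {q : J × ((l : Fin 0) → Bool → Fin 0 → Bool) // ∀ l, q.2 l false ≠ q.2 l true}
    have : Fintype B := Fintype.ofFinite _
    have : Nonempty B := ⟨⟨(Classical.arbitrary J, fun l => l.elim0), fun l => l.elim0⟩⟩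
    refine ⟨fun _ => 0, 2 ^ Fintype.card B, fun l => l.elim0, by positivity,
      fun G _ _ I _ _ H f hf => ?_⟩
    rw [← eavgR_equiv (Equiv.funUnique ((Σ _ : Fin 0, Fin 0) → Bool) I)]
    refine eavgR_subBox_pow_le_of_injective
      (p := fun j => (⟨(j, fun l => l.elim0), fun l => l.elim0⟩ : B)) ?_ ?_ hf
    · intro j j' hjj
      simpa using congrArg (fun b => b.1.1) hjj
    · intro i j
      refine iSup_le fun b => (congrArg (fun x => H (i x) j) (Subsingleton.elim _ _)).le
  | succ k ih =>
    intro J _ _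
    obtain ⟨w₀, t₀, hw₀, ht₀, h₀⟩ := exists_eavgR_subBox_cube J
    let J' := {q : J × (Bool → Fin w₀ → Bool) // q.2 false ≠ q.2 true}
    have : Nonempty J' := ⟨⟨(Classical.arbitrary J, fun b _ => b), fun h => by
      simpa using congrFun h ⟨0, hw₀⟩⟩⟩
    obtain ⟨w₁, t₁, hw₁, ht₁, h₁⟩ := ih J'
    let w : Fin (k + 1) → ℕ := Fin.cons w₀ w₁
    have hw : ∀ l, 0 < w l := Fin.cases hw₀ hw₁
    let B := {q : J × ((l : Fin (k + 1)) → Bool → Fin (w l) → Bool) //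
      ∀ l, q.2 l false ≠ q.2 l true}
    have : Fintype B := Fintype.ofFinite _
    have : Nonempty B := ⟨⟨(Classical.arbitrary J, fun l b _ => b), fun l h => by
      simpa using congrFun h ⟨0, hw l⟩⟩⟩
    refine ⟨w, t₀ * t₁ * 2 ^ Fintype.card B, hw, by positivity, fun G _ _ I _ _ H f hf => ?_⟩
    have h0 : 0 ≤ eavgR fun i => (subBox (H i) f).re :=
      eavgR_nonneg fun i => cubeAvg_re_nonneg _ f
    let e : ((Σ l : Fin k, Fin (w₁ l)) → Bool) × (Fin w₀ → Bool) →
        (Σ l : Fin (k + 1), Fin (w l)) → Bool := fun x z =>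
      Fin.cases (motive := fun l => Fin (w l) → Bool) x.2 (fun l a => x.1 ⟨l, a⟩) z.1 z.2
    have he : Function.Injective e := by
      rintro ⟨x, y⟩ ⟨x', y'⟩ h
      refine Prod.ext (funext fun z => ?_) (funext fun a => ?_)
      · exact congrFun h ⟨z.1.succ, z.2⟩
      · exact congrFun h ⟨0, a⟩
    rw [pow_mul, pow_mul]
    refine (pow_le_pow_left₀ (by positivity) ((pow_le_pow_left₀ (by positivity)
      (h₀ G I H f hf) _).trans (h₁ G ((Fin w₀ → Bool) → I) _ f hf)) _).trans ?_
    rw [← eavgR_equiv (Equiv.curry ((Σ l : Fin k, Fin (w₁ l)) → Bool) (Fin w₀ → Bool) I),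
      ← eavgR_comp_injective e he]
    refine eavgR_subBox_pow_le_of_injective (p := fun a => (⟨(a.1.1.1.1,
      fun l => Fin.cases (motive := fun l => Bool → Fin (w l) → Bool) a.1.1.1.2 a.1.2 l),
      Fin.cases a.1.1.2 a.2⟩ : B)) ?_ ?_ hf
    · rintro ⟨⟨⟨⟨j, x⟩, hx⟩, y⟩, hy⟩ ⟨⟨⟨⟨j', x'⟩, hx'⟩, y'⟩, hy'⟩ h
      have h2 : j = j' := congrArg (fun b => b.1.1) h
      have h3 : x = x' := congrArg (fun b => b.1.2 0) h
      have h4 : y = y' := funext fun l => congrArg (fun b => b.1.2 l.succ) h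
      subst h2 h3 h4
      rfl
    · intro i a
      refine iSup_le fun b => ?_
      refine le_trans (le_of_eq ?_) (le_iSup_of_le (fun l => b l.succ) (le_iSup _ (b 0)))
      congr 2
      ext z
      obtain ⟨l, z⟩ := z
      refine Fin.cases (fun z => ?_) (fun l z => ?_) l z <;> rfl

lemma boxNorm_eq {G A : Type*} [AddCommGroup G] [Finite G] [Finite A] (H : A → AddSubgroup G)
    (f : G → ℂ) : boxNorm H f = (subBox H f).re ^ ((1 : ℝ) / 2 ^ Nat.card A) :=
  rfl

lemma boxNorm_pow {G A : Type*} [AddCommGroup G] [Finite G] [Finite A] [Nonempty A]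
    (H : A → AddSubgroup G) (f : G → ℂ) : boxNorm H f ^ 2 ^ Nat.card A = (subBox H f).re := by
  have h : 0 ≤ (subBox H f).re := cubeAvg_re_nonneg _ f
  rw [boxNorm_eq, ← Real.rpow_natCast, ← Real.rpow_mul h]
  simp

lemma re_subBox_le_boxNorm {G A : Type*} [AddCommGroup G] [Finite G] [Finite A] [Nonempty A]
    (H : A → AddSubgroup G) {f : G → ℂ} (hf : ∀ x, ‖f x‖ ≤ 1) :
    (subBox H f).re ≤ boxNorm H f := by
  rw [boxNorm_eq]
  refine Real.self_le_rpow_of_le_one (cubeAvg_re_nonneg _ f)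
    ((Complex.re_le_norm _).trans (norm_cubeAvg_le_one _ hf)) ?_
  rw [div_le_one (by positivity)]
  exact one_le_pow₀ one_le_two

/-- Corollary 2.7, iterated concatenation of box norms. Tuples in
`{0,1}^{w_1+⋯+w_k}` are modelled as functions `(Σ l : Fin k, Fin (w l)) → Bool`, so that the
concatenation `ε_{1b_1}⋯ε_{kb_k}` of blocks `ε_{l,b} ∈ {0,1}^{w_l}` is
`fun z => E z.1 (b z.1) z.2`, and the sum of subgroups is an `iSup`. -/
theorem statement7 (s k : ℕ) :
    ∃ (w : Fin k → ℕ) (t : ℕ), 0 < t ∧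
      ∀ (G : Type*) [AddCommGroup G] [Finite G] (I : Type*) [Finite I] [Nonempty I]
        (H : I → Fin s → AddSubgroup G) (f : G → ℂ), (∀ x, ‖f x‖ ≤ 1) →
        (eavgR fun i : I => boxNorm (H i) f ^ 2 ^ s) ^ t ≤
          eavgR fun ii : ((Σ l : Fin k, Fin (w l)) → Bool) → I =>
            boxNorm
              (fun q : {q : Fin s × ((l : Fin k) → Bool → Fin (w l) → Bool) //
                  ∀ l, q.2 l false ≠ q.2 l true} =>
                ⨆ b : Fin k → Bool,
                  H (ii fun z : Σ l : Fin k, Fin (w l) => q.1.2 z.1 (b z.1) z.2) q.1.1) f := by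
  rcases s with _ | s
  · refine ⟨fun _ => 0, 1, one_pos, fun G _ _ I _ _ H f _ => ?_⟩
    simp only [boxNorm_eq, subBox, cubeAvg_isEmpty, Nat.card_of_isEmpty]
    simp [eavgR_const]
  · obtain ⟨w, t, hw, ht, h⟩ := exists_eavgR_subBox_iterated k (Fin (s + 1))
    refine ⟨w, t, ht, fun G _ _ I _ _ H f hf => ?_⟩
    have : Nonempty {q : Fin (s + 1) × ((l : Fin k) → Bool → Fin (w l) → Bool) //
        ∀ l, q.2 l false ≠ q.2 l true} :=
      ⟨⟨(0, fun l b _ => b), fun l hl => by simpa using congrFun hl ⟨0, hw l⟩⟩⟩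
    have h1 : ∀ i, boxNorm (H i) f ^ 2 ^ (s + 1) = (subBox (H i) f).re := fun i => by
      simpa using boxNorm_pow (H i) f
    simp only [h1]
    exact (h G I H f hf).trans (eavgR_mono fun ii => re_subBox_le_boxNorm _ hf)

end
end

section
/- Let D ∈ ℕ, let p be a prime, let v ∈ ℤ^D, and let f : F_p^D → ℂ be 1-bounded. Then there exists an eigenfunction χ ∈ ℰ(v) with |χ(x)| = 1 for all x ∈ F_p^D such that ‖f‖_{U^2(v)}^4 ≤ E_{x∈F_p^D} f(x)χ(x) (in particular the right-hand side is a nonnegative real number) and, moreover, E(f·χ | v)(x) is a nonnegative real number for every x ∈ F_p^D. -/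
open Finset Polynomial
open scoped BigOperators

noncomputable section


open scoped ComplexConjugate

lemma ep_eq_stdAddChar (p : ℕ) [NeZero p] (t : ZMod p) : ep p t = ZMod.stdAddChar t := by
  rw [ZMod.stdAddChar_apply, ZMod.toCircle_apply]; rfl

lemma eavg_eq {α : Type*} [Fintype α] (f : α → ℂ) :
    eavg f = (∑ x, f x) / (Fintype.card α : ℂ) := by
  unfold eavg
  rw [Nat.card_eq_fintype_card]
  congr!

/-- The unnormalised Fourier coefficient of `g` at `ξ`. -/
def fourierSum (p : ℕ) [NeZero p] (g : ZMod p → ℂ) (ξ : ZMod p) : ℂ :=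
  ∑ n, ZMod.stdAddChar (ξ * n) * g n

/-- The unnormalised autocorrelation of `g`. -/
def autocorr (p : ℕ) [NeZero p] (g : ZMod p → ℂ) (h : ZMod p) : ℂ :=
  ∑ n, g n * conj (g (n + h))

lemma fourierSum_shift (p : ℕ) [NeZero p] (g : ZMod p → ℂ) (m ξ : ZMod p) :
    fourierSum p (fun n => g (n + m)) ξ = ZMod.stdAddChar (-(ξ * m)) * fourierSum p g ξ := by
  unfold fourierSum
  rw [← Equiv.sum_comp (Equiv.addRight m) (fun n => ZMod.stdAddChar (ξ * n) * g n),
    Finset.mul_sum]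
  refine Finset.sum_congr rfl fun n _ => ?_
  simp only [Equiv.coe_addRight]
  rw [← mul_assoc, ← AddChar.map_add_eq_mul]
  congr 2
  ring

lemma sum_norm_fourierSum_sq (p : ℕ) [NeZero p] (g : ZMod p → ℂ) :
    ∑ ξ, ‖fourierSum p g ξ‖ ^ 2 = p * ∑ n, ‖g n‖ ^ 2 := by
  have key : ∑ ξ, fourierSum p g ξ * conj (fourierSum p g ξ) = p * ∑ n, g n * conj (g n) := by
    unfold fourierSum
    simp_rw [map_sum, Finset.sum_mul_sum]
    rw [Finset.sum_comm, Finset.mul_sum]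
    refine Finset.sum_congr rfl fun n _ => ?_
    rw [Finset.sum_comm]
    have : ∀ m : ZMod p, ∑ ξ : ZMod p, ZMod.stdAddChar (ξ * n) * g n *
        conj (ZMod.stdAddChar (ξ * m) * g m) =
        (if n - m = 0 then (p : ℂ) else 0) * (g n * conj (g m)) := by
      intro m
      have h := AddChar.sum_mulShift (n - m) (ZMod.isPrimitive_stdAddChar p)
      rw [ZMod.card] at h
      push_cast at h
      rw [← h, Finset.sum_mul]
      refine Finset.sum_congr rfl fun ξ _ => ?_
      rw [map_mul (starRingEnd ℂ), ← AddChar.map_neg_eq_conj, mul_sub, sub_eq_add_neg, AddChar.map_add_eq_mul]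
      ring
    simp_rw [this, sub_eq_zero]
    simp
  simp_rw [Complex.mul_conj'] at key
  exact_mod_cast key

lemma norm_fourierSum_autocorr (p : ℕ) [NeZero p] (g : ZMod p → ℂ) (ξ : ZMod p) :
    ‖fourierSum p (autocorr p g) ξ‖ = ‖fourierSum p g (-ξ)‖ ^ 2 := by
  have : fourierSum p (autocorr p g) ξ =
      fourierSum p g (-ξ) * conj (fourierSum p g (-ξ)) := by
    unfold fourierSum autocorr
    simp_rw [map_sum, Finset.sum_mul_sum, Finset.mul_sum]
    rw [Finset.sum_comm]
    refine Finset.sum_congr rfl fun n _ => ?_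
    rw [← Equiv.sum_comp (Equiv.addLeft n) fun m => ZMod.stdAddChar (-ξ * n) * g n *
      conj (ZMod.stdAddChar (-ξ * m) * g m)]
    refine Finset.sum_congr rfl fun h _ => ?_
    simp only [Equiv.coe_addLeft]
    rw [map_mul (starRingEnd ℂ), ← AddChar.map_neg_eq_conj]
    have : ξ * h = -ξ * n + -(-ξ * (n + h)) := by ring
    rw [this, AddChar.map_add_eq_mul]
    ring
  rw [this, norm_mul, RCLike.norm_conj, sq]

lemma sum_norm_autocorr_sq_le (p : ℕ) [NeZero p] (g : ZMod p → ℂ) (hg : ∀ n, ‖g n‖ ≤ 1)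
    (M : ℝ) (hM : ∀ ξ, ‖fourierSum p g ξ‖ ≤ M) (hMp : M ≤ p) :
    ∑ h, ‖autocorr p g h‖ ^ 2 ≤ p ^ 2 * M := by
  have hp : (0 : ℝ) < p := by exact_mod_cast NeZero.pos p
  have hM0 : 0 ≤ M := (norm_nonneg _).trans (hM 0)
  have h1 : (p : ℝ) * ∑ h, ‖autocorr p g h‖ ^ 2 ≤ M ^ 2 * (p * ∑ n, ‖g n‖ ^ 2) := by
    rw [← sum_norm_fourierSum_sq, ← sum_norm_fourierSum_sq, Finset.mul_sum,
      ← Equiv.sum_comp (Equiv.neg (ZMod p))]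
    refine Finset.sum_le_sum fun ξ _ => ?_
    rw [norm_fourierSum_autocorr, Equiv.neg_apply, neg_neg, sq (‖_‖ ^ 2)]
    gcongr
    exact hM ξ
  have h2 : ∑ n, ‖g n‖ ^ 2 ≤ (p : ℝ) := by
    calc ∑ n, ‖g n‖ ^ 2 ≤ ∑ _n : ZMod p, (1 : ℝ) :=
          Finset.sum_le_sum fun n _ => pow_le_one₀ (norm_nonneg _) (hg n)
      _ = p := by simp
  have h3 : M ^ 2 * (p * ∑ n, ‖g n‖ ^ 2) ≤ p * (p ^ 2 * M) := by
    calc M ^ 2 * (p * ∑ n, ‖g n‖ ^ 2) ≤ (p * M) * (p * p) := by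
          rw [sq]
          gcongr
      _ = p * (p ^ 2 * M) := by ring
  exact le_of_mul_le_mul_left (h1.trans h3) hp

/-- The restriction of `f` to the line through `x` in direction `v`. -/
def lineRestrict (p : ℕ) {D : ℕ} (v : Fin D → ℤ) (f : (Fin D → ZMod p) → ℂ)
    (x : Fin D → ZMod p) (n : ZMod p) : ℂ :=
  f (x + fun k => n * (v k : ZMod p))

lemma lineRestrict_shift (p : ℕ) {D : ℕ} (v : Fin D → ℤ) (f : (Fin D → ZMod p) → ℂ)
    (x : Fin D → ZMod p) (m : ZMod p) :
    lineRestrict p v f (x + fun k => m * (v k : ZMod p)) =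
      fun n => lineRestrict p v f x (n + m) := by
  funext n
  unfold lineRestrict
  congr 1
  funext k
  simp only [Pi.add_apply]
  ring

lemma sum_eq_sum_lines (p : ℕ) [NeZero p] {D : ℕ} (v : Fin D → ℤ)
    (Q : (Fin D → ZMod p) → ℂ) :
    (p : ℂ) * ∑ x, Q x = ∑ x, ∑ n, lineRestrict p v Q x n := by
  unfold lineRestrict
  rw [Finset.sum_comm]
  have : ∀ n : ZMod p, ∑ x : Fin D → ZMod p, Q (x + fun k => n * (v k : ZMod p)) = ∑ x, Q x :=
    fun n => Equiv.sum_comp (Equiv.addRight fun k => n * (v k : ZMod p)) Q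
  simp [this]

lemma sum_fin_two_fun {α M : Type*} [Fintype α] [AddCommMonoid M] (F : (Fin 2 → α) → M) :
    ∑ h, F h = ∑ a, ∑ b, F ![a, b] := by
  rw [← Equiv.sum_comp (finTwoArrowEquiv α).symm, Fintype.sum_prod_type]
  rfl

lemma prod_fin_two_fun {α M : Type*} [Fintype α] [CommMonoid M] (F : (Fin 2 → α) → M) :
    ∏ h, F h = ∏ a, ∏ b, F ![a, b] := by
  rw [← Equiv.prod_comp (finTwoArrowEquiv α).symm, Fintype.prod_prod_type]
  rfl

lemma epsWt_cons_cons (a b : Bool) :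
    epsWt ![a, b] = (if a then 1 else 0) + if b then 1 else 0 := by
  have h : epsWt ![a, b] = ∑ i, if ![a, b] i then 1 else 0 := by
    unfold epsWt
    congr!
  rw [h, Fin.sum_univ_two]
  rfl

lemma prod_conjIter_eq (p : ℕ) {D : ℕ} (v : Fin D → ℤ) (f : (Fin D → ZMod p) → ℂ)
    (x : Fin D → ZMod p) (a b : ZMod p) :
    ∏ ε : Fin 2 → Bool, conjIter (epsWt ε)
        (f (x + fun k => (∑ i, if ε i then ![a, b] i else 0) * (v k : ZMod p))) =
      lineRestrict p v f x 0 * conj (lineRestrict p v f x a) *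
        conj (lineRestrict p v f x b) * lineRestrict p v f x (a + b) := by
  rw [prod_fin_two_fun]
  simp [epsWt_cons_cons, conjIter, lineRestrict, Fin.sum_univ_two]
  ring

lemma sum_lines_gowers (p : ℕ) [NeZero p] {D : ℕ} (v : Fin D → ℤ) (f : (Fin D → ZMod p) → ℂ) :
    (p : ℂ) * ∑ x, ∑ h : Fin 2 → ZMod p, ∏ ε : Fin 2 → Bool, conjIter (epsWt ε)
        (f (x + fun k => (∑ i, if ε i then h i else 0) * (v k : ZMod p))) =
      ((∑ x, ∑ h, ‖autocorr p (lineRestrict p v f x) h‖ ^ 2 : ℝ) : ℂ) := by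
  rw [sum_eq_sum_lines p v]
  push_cast
  refine Finset.sum_congr rfl fun x _ => ?_
  have : ∀ n, lineRestrict p v (fun x => ∑ h : Fin 2 → ZMod p, ∏ ε : Fin 2 → Bool,
      conjIter (epsWt ε)
        (f (x + fun k => (∑ i, if ε i then h i else 0) * (v k : ZMod p)))) x n =
      ∑ a, ∑ b, lineRestrict p v f x n * conj (lineRestrict p v f x (n + a)) *
        conj (lineRestrict p v f x (n + b) * conj (lineRestrict p v f x (n + b + a))) := by
    intro n
    rw [lineRestrict, sum_fin_two_fun]
    refine Finset.sum_congr rfl fun a _ => Finset.sum_congr rfl fun b _ => ?_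
    have hab : a + b + n = n + b + a := by ring
    rw [prod_conjIter_eq, lineRestrict_shift, map_mul, Complex.conj_conj]
    beta_reduce
    rw [hab, zero_add, add_comm a n, add_comm b n]
    ring
  simp_rw [this]
  rw [Finset.sum_comm]
  refine Finset.sum_congr rfl fun a _ => ?_
  rw [← Complex.mul_conj', autocorr, map_sum, Finset.sum_mul_sum]
  refine Finset.sum_congr rfl fun n _ => ?_
  exact Equiv.sum_comp (Equiv.addLeft n) fun m => lineRestrict p v f x n *
    conj (lineRestrict p v f x (n + a)) *
      conj (lineRestrict p v f x m * conj (lineRestrict p v f x (m + a)))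

lemma gowersU_two_pow_four (p : ℕ) [NeZero p] {D : ℕ} (v : Fin D → ℤ)
    (f : (Fin D → ZMod p) → ℂ) :
    gowersU p 2 v f ^ 4 =
      (∑ x, ∑ h, ‖autocorr p (lineRestrict p v f x) h‖ ^ 2) /
        ((p : ℝ) ^ 3 * Fintype.card (Fin D → ZMod p)) := by
  have hp : (p : ℂ) ≠ 0 := by exact_mod_cast NeZero.ne p
  have key : (eavg fun x : Fin D → ZMod p => eavg fun h : Fin 2 → ZMod p =>
      ∏ ε : Fin 2 → Bool, conjIter (epsWt ε)
        (f (x + fun k => (∑ i, if ε i then h i else 0) * (v k : ZMod p)))) =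
      (((∑ x, ∑ h, ‖autocorr p (lineRestrict p v f x) h‖ ^ 2) /
        ((p : ℝ) ^ 3 * Fintype.card (Fin D → ZMod p)) : ℝ) : ℂ) := by
    rw [Complex.ofReal_div, ← sum_lines_gowers]
    simp_rw [eavg_eq]
    rw [← Finset.sum_div]
    have hc : Fintype.card (Fin 2 → ZMod p) = p ^ 2 := by simp
    have hD : (Fintype.card (Fin D → ZMod p) : ℂ) ≠ 0 := by
      exact_mod_cast Fintype.card_ne_zero
    rw [hc]
    push_cast
    field_simp
  rw [gowersU, key, Complex.ofReal_re, ← Real.rpow_natCast, ← Real.rpow_mul (by positivity)]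
  norm_num

/-- A frequency at which the function `F` of frequencies is maximal. -/
def maxFreq (p : ℕ) [NeZero p] (F : ZMod p → ℝ) : ZMod p :=
  (Finite.exists_max F).choose

lemma le_maxFreq (p : ℕ) [NeZero p] (F : ZMod p → ℝ) (ξ : ZMod p) : F ξ ≤ F (maxFreq p F) :=
  (Finite.exists_max F).choose_spec ξ

/-- A frequency maximising the Fourier transform of `f` along the line through `x`. -/
def lineFreq (p : ℕ) [NeZero p] {D : ℕ} (v : Fin D → ℤ) (f : (Fin D → ZMod p) → ℂ)
    (x : Fin D → ZMod p) : ZMod p :=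
  maxFreq p fun ξ => ‖fourierSum p (lineRestrict p v f x) ξ‖

/-- The maximal Fourier coefficient of `f` along the line through `x`. -/
def lineCoeff (p : ℕ) [NeZero p] {D : ℕ} (v : Fin D → ℤ) (f : (Fin D → ZMod p) → ℂ)
    (x : Fin D → ZMod p) : ℂ :=
  fourierSum p (lineRestrict p v f x) (lineFreq p v f x)

lemma lineFreq_shift (p : ℕ) [NeZero p] {D : ℕ} (v : Fin D → ℤ) (f : (Fin D → ZMod p) → ℂ)
    (x : Fin D → ZMod p) (m : ZMod p) :
    lineFreq p v f (x + fun k => m * (v k : ZMod p)) = lineFreq p v f x := by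
  unfold lineFreq
  congr 1
  funext ξ
  rw [lineRestrict_shift, fourierSum_shift, norm_mul, AddChar.norm_apply, one_mul]

lemma lineCoeff_shift (p : ℕ) [NeZero p] {D : ℕ} (v : Fin D → ℤ) (f : (Fin D → ZMod p) → ℂ)
    (x : Fin D → ZMod p) (m : ZMod p) :
    lineCoeff p v f (x + fun k => m * (v k : ZMod p)) =
      ZMod.stdAddChar (-(lineFreq p v f x * m)) * lineCoeff p v f x := by
  rw [lineCoeff, lineFreq_shift, lineRestrict_shift, fourierSum_shift]
  rfl

open Classical in
/-- The eigenvalue of the unimodular eigenfunction correlating with `f`. -/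
def dualPhase (p : ℕ) [NeZero p] {D : ℕ} (v : Fin D → ℤ) (f : (Fin D → ZMod p) → ℂ)
    (x : Fin D → ZMod p) : ZMod p :=
  if lineCoeff p v f x = 0 then 0 else lineFreq p v f x

open Classical in
/-- The unimodular eigenfunction correlating with `f`. -/
def dualEigen (p : ℕ) [NeZero p] {D : ℕ} (v : Fin D → ℤ) (f : (Fin D → ZMod p) → ℂ)
    (x : Fin D → ZMod p) : ℂ :=
  if lineCoeff p v f x = 0 then 1 else conj (lineCoeff p v f x) / ‖lineCoeff p v f x‖

lemma lineCoeff_shift_eq_zero (p : ℕ) [NeZero p] {D : ℕ} (v : Fin D → ℤ)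
    (f : (Fin D → ZMod p) → ℂ) (x : Fin D → ZMod p) (m : ZMod p) :
    lineCoeff p v f (x + fun k => m * (v k : ZMod p)) = 0 ↔ lineCoeff p v f x = 0 := by
  rw [← norm_eq_zero, lineCoeff_shift, norm_mul, AddChar.norm_apply, one_mul, norm_eq_zero]

lemma dualPhase_shift (p : ℕ) [NeZero p] {D : ℕ} (v : Fin D → ℤ) (f : (Fin D → ZMod p) → ℂ)
    (x : Fin D → ZMod p) (m : ZMod p) :
    dualPhase p v f (x + fun k => m * (v k : ZMod p)) = dualPhase p v f x := by
  simp only [dualPhase, lineCoeff_shift_eq_zero, lineFreq_shift]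

lemma dualEigen_shift (p : ℕ) [NeZero p] {D : ℕ} (v : Fin D → ℤ) (f : (Fin D → ZMod p) → ℂ)
    (x : Fin D → ZMod p) (m : ZMod p) :
    dualEigen p v f (x + fun k => m * (v k : ZMod p)) =
      ZMod.stdAddChar (dualPhase p v f x * m) * dualEigen p v f x := by
  simp only [dualEigen, dualPhase, lineCoeff_shift_eq_zero]
  split_ifs with h
  · simp
  · rw [lineCoeff_shift, norm_mul, AddChar.norm_apply, one_mul, map_mul,
      ← AddChar.map_neg_eq_conj, neg_neg, mul_div_assoc]

lemma norm_dualEigen (p : ℕ) [NeZero p] {D : ℕ} (v : Fin D → ℤ) (f : (Fin D → ZMod p) → ℂ)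
    (x : Fin D → ZMod p) : ‖dualEigen p v f x‖ = 1 := by
  unfold dualEigen
  split_ifs with h
  · simp
  · rw [norm_div, RCLike.norm_conj, Complex.norm_real, norm_norm,
      div_self (norm_ne_zero_iff.mpr h)]

lemma isEigenfunction_dualEigen (p : ℕ) [NeZero p] {D : ℕ} (v : Fin D → ℤ)
    (f : (Fin D → ZMod p) → ℂ) : IsEigenfunction p v (dualEigen p v f) := by
  have hv : redv p v = fun k => (1 : ZMod p) * (v k : ZMod p) := by
    funext k
    simp [redv]
  refine ⟨dualPhase p v f, fun x => Or.inr (norm_dualEigen p v f x), fun x => ?_, fun x => ?_⟩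
  · rw [hv, dualEigen_shift, ep_eq_stdAddChar, mul_one]
  · rw [hv, dualPhase_shift]

lemma sum_line_mul_dualEigen (p : ℕ) [NeZero p] {D : ℕ} (v : Fin D → ℤ)
    (f : (Fin D → ZMod p) → ℂ) (x : Fin D → ZMod p) :
    ∑ n, lineRestrict p v (fun y => f y * dualEigen p v f y) x n = ‖lineCoeff p v f x‖ := by
  have h1 : ∑ n, lineRestrict p v (fun y => f y * dualEigen p v f y) x n =
      fourierSum p (lineRestrict p v f x) (dualPhase p v f x) * dualEigen p v f x := by
    rw [fourierSum, Finset.sum_mul]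
    refine Finset.sum_congr rfl fun n _ => ?_
    rw [lineRestrict, dualEigen_shift, lineRestrict]
    ring
  rw [h1]
  by_cases h : lineCoeff p v f x = 0
  · have h0 : fourierSum p (lineRestrict p v f x) (dualPhase p v f x) = 0 := by
      rw [← norm_le_zero_iff]
      calc ‖fourierSum p (lineRestrict p v f x) (dualPhase p v f x)‖ ≤ ‖lineCoeff p v f x‖ :=
            le_maxFreq p (fun ξ => ‖fourierSum p (lineRestrict p v f x) ξ‖) _
        _ = 0 := by rw [h, norm_zero]
    rw [h0, h]
    simp
  · have hn : (‖lineCoeff p v f x‖ : ℂ) ≠ 0 := by exact_mod_cast norm_ne_zero_iff.mpr h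
    rw [dualPhase, dualEigen, if_neg h, if_neg h, ← lineCoeff, ← mul_div_assoc,
      Complex.mul_conj', sq, mul_div_assoc, div_self hn, mul_one]

lemma condAvg_mul_dualEigen (p : ℕ) [NeZero p] {D : ℕ} (v : Fin D → ℤ)
    (f : (Fin D → ZMod p) → ℂ) (x : Fin D → ZMod p) :
    condAvg p v (fun y => f y * dualEigen p v f y) x =
      ((‖lineCoeff p v f x‖ / p : ℝ) : ℂ) := by
  have h := sum_line_mul_dualEigen p v f x
  unfold lineRestrict at h
  rw [condAvg, eavg_eq, h, ZMod.card]
  push_cast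
  rfl

lemma eavg_mul_dualEigen (p : ℕ) [NeZero p] {D : ℕ} (v : Fin D → ℤ)
    (f : (Fin D → ZMod p) → ℂ) :
    (eavg fun x => f x * dualEigen p v f x) =
      (((∑ x, ‖lineCoeff p v f x‖) / (p * Fintype.card (Fin D → ZMod p)) : ℝ) : ℂ) := by
  have hp : (p : ℂ) ≠ 0 := by exact_mod_cast NeZero.ne p
  have h := sum_eq_sum_lines p v fun x => f x * dualEigen p v f x
  simp_rw [sum_line_mul_dualEigen] at h
  rw [eavg_eq, Complex.ofReal_div, Complex.ofReal_sum, ← h, Complex.ofReal_mul,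
    Complex.ofReal_natCast, Complex.ofReal_natCast, mul_div_mul_left _ _ hp]

lemma norm_lineCoeff_le (p : ℕ) [NeZero p] {D : ℕ} (v : Fin D → ℤ)
    (f : (Fin D → ZMod p) → ℂ) (hf : ∀ x, ‖f x‖ ≤ 1) (x : Fin D → ZMod p) :
    ‖lineCoeff p v f x‖ ≤ p := by
  calc ‖lineCoeff p v f x‖ ≤ ∑ _n : ZMod p, (1 : ℝ) := by
        refine norm_sum_le_of_le _ fun n _ => ?_
        rw [norm_mul, AddChar.norm_apply, one_mul]
        exact hf _
    _ = p := by simp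

lemma gowersU_two_pow_four_le (p : ℕ) [NeZero p] {D : ℕ} (v : Fin D → ℤ)
    (f : (Fin D → ZMod p) → ℂ) (hf : ∀ x, ‖f x‖ ≤ 1) :
    gowersU p 2 v f ^ 4 ≤
      (∑ x, ‖lineCoeff p v f x‖) / (p * Fintype.card (Fin D → ZMod p)) := by
  have hp : (0 : ℝ) < p := by exact_mod_cast NeZero.pos p
  have hD : (0 : ℝ) < Fintype.card (Fin D → ZMod p) := by exact_mod_cast Fintype.card_pos
  have h : ∑ x, ∑ h, ‖autocorr p (lineRestrict p v f x) h‖ ^ 2 ≤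
      p ^ 2 * ∑ x, ‖lineCoeff p v f x‖ := by
    rw [Finset.mul_sum]
    exact Finset.sum_le_sum fun x _ => sum_norm_autocorr_sq_le p _ (fun n => hf _) _
      (le_maxFreq p fun ξ => ‖fourierSum p (lineRestrict p v f x) ξ‖)
      (norm_lineCoeff_le p v f hf x)
  rw [gowersU_two_pow_four]
  calc _ ≤ (p ^ 2 * ∑ x, ‖lineCoeff p v f x‖) /
        ((p : ℝ) ^ 3 * Fintype.card (Fin D → ZMod p)) := by gcongr
    _ = _ := by field_simp

/-- Lemma 7.1, strong inverse theorem for `U²(v)`: there is an eigenfunction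
`χ ∈ ℰ(v)` of modulus one with `‖f‖_{U²(v)}⁴ ≤ E_x f(x)χ(x)` (the right-hand side being a
nonnegative real number), and moreover `E(f·χ | v)(x)` is a nonnegative real for every `x`. -/
theorem statement17 (D : ℕ) (p : ℕ) [Fact p.Prime] (v : Fin D → ℤ)
    (f : (Fin D → ZMod p) → ℂ) (hf : ∀ x, ‖f x‖ ≤ 1) :
    ∃ χ : (Fin D → ZMod p) → ℂ,
      IsEigenfunction p v χ ∧ (∀ x, ‖χ x‖ = 1) ∧
      (eavg fun x : Fin D → ZMod p => f x * χ x).im = 0 ∧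
      gowersU p 2 v f ^ 4 ≤ (eavg fun x : Fin D → ZMod p => f x * χ x).re ∧
      ∀ x, (condAvg p v (fun y => f y * χ y) x).im = 0 ∧
        0 ≤ (condAvg p v (fun y => f y * χ y) x).re := by
  refine ⟨dualEigen p v f, isEigenfunction_dualEigen p v f, norm_dualEigen p v f, ?_, ?_,
    fun x => ⟨?_, ?_⟩⟩
  · rw [eavg_mul_dualEigen, Complex.ofReal_im]
  · rw [eavg_mul_dualEigen, Complex.ofReal_re]
    exact gowersU_two_pow_four_le p v f hf
  · rw [condAvg_mul_dualEigen, Complex.ofReal_im]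
  · rw [condAvg_mul_dualEigen, Complex.ofReal_re]
    positivity

end
end
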